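/- arXiv:math/0701436 — 2 statements merged into one kernel-verified Lean document; each statement's English description precedes it below -/
import Mathlib

section
/- Let 0 < a, b < min{c,1} and c ≤ a+b, and suppose a+b > c. Then the function f(r) = (𝕂_{a,b,c}(r) − B(a,b)/2)/((1−r²)^{−(a+b−c)} − 1) is strictly increasing on (0,1), with f(r) → a·b·B(a,b)/(2c(a+b−c)) as r → 0+ and f(r) → B(c, a+b−c)/2 as r → 1−. -/
open Filter Set

/-- Shifted factorial (Appell symbol) `(a,n) = a(a+1)⋯(a+n−1)`, with `(a,0)=1`. -/
noncomputable def shiftedFact (a : ℝ) (n : ℕ) : ℝ := ∏ i ∈ Finset.range n, (a + i)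

/-- Gaussian hypergeometric function `F(a,b;c;x)` as a real power series. -/
noncomputable def hypF (a b c x : ℝ) : ℝ :=
  ∑' n : ℕ, (shiftedFact a n * shiftedFact b n / (shiftedFact c n * (n.factorial : ℝ))) * x ^ n

/-- Beta function `B(x,y) = Γ(x)Γ(y)/Γ(x+y)`. -/
noncomputable def betaR (x y : ℝ) : ℝ := Real.Gamma x * Real.Gamma y / Real.Gamma (x + y)

/-- Generalized complete elliptic integral of the first kind `𝕂_{a,b,c}(r)`. -/
noncomputable def Kg (a b c r : ℝ) : ℝ := betaR a b / 2 * hypF a b c (r ^ 2)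

/-- Generalized complete elliptic integral of the second kind `𝔼_{a,b,c}(r)`. -/
noncomputable def Eg (a b c r : ℝ) : ℝ := betaR a b / 2 * hypF (a - 1) b c (r ^ 2)

theorem HasSum.pos_of_nonneg {g : ℕ → ℝ} {s : ℝ} (hg : ∀ n, 0 ≤ g n) (i : ℕ) (hi : 0 < g i)
    (h : HasSum g s) : 0 < s :=
  hi.trans_le (le_hasSum h i fun n _ => hg n)

theorem div_lt_div_of_hasSum_of_strictMono {v R : ℕ → ℝ} (hv : ∀ n, 0 < v n) (hR : StrictMono R)
    {x y Ux Vx Uy Vy : ℝ} (hx : 0 < x) (hxy : x < y)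
    (hVx : HasSum (fun n => v n * x ^ (n + 1)) Vx)
    (hUx : HasSum (fun n => R n * v n * x ^ (n + 1)) Ux)
    (hVy : HasSum (fun n => v n * y ^ (n + 1)) Vy)
    (hUy : HasSum (fun n => R n * v n * y ^ (n + 1)) Uy) :
    Ux / Vx < Uy / Vy := by
  have hy : 0 < y := hx.trans hxy
  have hVx0 : 0 < Vx := HasSum.pos_of_nonneg (fun n => (mul_pos (hv n) (pow_pos hx _)).le) 0
    (mul_pos (hv 0) (pow_pos hx _)) hVx
  have hVy0 : 0 < Vy := HasSum.pos_of_nonneg (fun n => (mul_pos (hv n) (pow_pos hy _)).le) 0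
    (mul_pos (hv 0) (pow_pos hy _)) hVy
  set l := Ux / Vx with hl
  have hzero : HasSum (fun n => (R n - l) * (v n * x ^ (n + 1))) 0 := by
    have h := hUx.sub (hVx.mul_left l)
    rw [hl, div_mul_cancel₀ _ hVx0.ne', sub_self] at h
    exact h.congr_fun fun n => by ring
  have hex : ∃ N, l < R N := by
    by_contra! hle
    have h : (0 : ℝ) < 0 := by
      refine HasSum.pos_of_nonneg (g := fun n => -((R n - l) * (v n * x ^ (n + 1)))) (fun n => ?_) 0 ?_
        (by simpa using hzero.neg)
      · have := mul_nonneg (sub_nonneg.2 (hle n)) (mul_pos (hv n) (pow_pos hx (n + 1))).le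
        linarith
      · have := mul_pos (sub_pos.2 ((hR zero_lt_one).trans_le (hle 1)))
          (mul_pos (hv 0) (pow_pos hx (0 + 1)))
        linarith
    exact h.false
  classical
  set N := Nat.find hex
  have hN : l < R N := Nat.find_spec hex
  set t := y / x
  have ht : 1 < t := (one_lt_div hx).2 hxy
  have hyt : y = t * x := (div_mul_cancel₀ y hx.ne').symm
  have hsum : HasSum (fun n => (R n - l) * (v n * x ^ (n + 1)) * (t ^ (n + 1) - t ^ (N + 1)))
      (Uy - l * Vy) := by
    have h := (hUy.sub (hVy.mul_left l)).sub (hzero.mul_left (t ^ (N + 1)))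
    rw [mul_zero, sub_zero] at h
    refine h.congr_fun fun n => ?_
    rw [hyt, mul_pow]
    ring
  have hpos : 0 < Uy - l * Vy := by
    refine HasSum.pos_of_nonneg (fun n => ?_) (N + 1) ?_ hsum
    · have hp := mul_pos (hv n) (pow_pos hx (n + 1))
      rcases lt_or_ge n N with hn | hn
      · have h1 : R n ≤ l := not_lt.1 (Nat.find_min hex hn)
        have h2 : t ^ (n + 1) ≤ t ^ (N + 1) := pow_le_pow_right₀ ht.le (by lia)
        exact mul_nonneg_of_nonpos_of_nonpos
          (mul_nonpos_of_nonpos_of_nonneg (by linarith) hp.le) (by linarith)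
      · have h1 : l < R n := hN.trans_le (hR.monotone hn)
        have h2 : t ^ (N + 1) ≤ t ^ (n + 1) := pow_le_pow_right₀ ht.le (by lia)
        exact mul_nonneg (mul_nonneg (by linarith) hp.le) (by linarith)
    · have h1 : l < R (N + 1) := hN.trans (hR (Nat.lt_succ_self N))
      have h2 : t ^ (N + 1) < t ^ (N + 1 + 1) := pow_lt_pow_right₀ ht (Nat.lt_succ_self _)
      exact mul_pos (mul_pos (by linarith) (mul_pos (hv _) (pow_pos hx _))) (by linarith)
  rw [lt_div_iff₀ hVy0]
  linarith

theorem tendsto_div_nhdsGT_zero_of_hasSum {v R : ℕ → ℝ} {L : ℝ} (hv : ∀ n, 0 < v n)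
    (hR : Monotone R) (hRL : ∀ n, R n ≤ L) {U V : ℝ → ℝ}
    (hV : ∀ x ∈ Ioo (0 : ℝ) 1, HasSum (fun n => v n * x ^ (n + 1)) (V x))
    (hU : ∀ x ∈ Ioo (0 : ℝ) 1, HasSum (fun n => R n * v n * x ^ (n + 1)) (U x))
    (hV' : HasDerivAt V (v 0) 0) (hV0 : V 0 = 0) :
    Tendsto (fun x => U x / V x) (nhdsWithin 0 (Ioi 0)) (nhds (R 0)) := by
  have hq : Tendsto (fun x => V x / x) (nhdsWithin 0 (Ioi 0)) (nhds (v 0)) := by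
    refine ((hasDerivAt_iff_tendsto_slope.1 hV').mono_left
      (nhdsWithin_mono _ fun x hx => ne_of_gt hx)).congr fun x => ?_
    simp [slope_def_field, hV0]
  have hup : Tendsto (fun x => L - (L - R 0) * v 0 * (V x / x)⁻¹) (nhdsWithin 0 (Ioi 0))
      (nhds (R 0)) := by
    have h := (hq.inv₀ (hv 0).ne').const_mul ((L - R 0) * v 0) |>.const_sub L
    rwa [mul_assoc, mul_inv_cancel₀ (hv 0).ne', mul_one, sub_sub_cancel] at h
  have hmem : Ioo (0 : ℝ) 1 ∈ nhdsWithin (0 : ℝ) (Ioi 0) := Ioo_mem_nhdsGT zero_lt_one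
  have hVpos : ∀ x ∈ Ioo (0 : ℝ) 1, 0 < V x := fun x hx =>
    HasSum.pos_of_nonneg (fun n => (mul_pos (hv n) (pow_pos hx.1 _)).le) 0
      (mul_pos (hv 0) (pow_pos hx.1 _)) (hV x hx)
  refine tendsto_of_tendsto_of_tendsto_of_le_of_le' tendsto_const_nhds hup ?_ ?_
  · filter_upwards [hmem] with x hx
    rw [le_div_iff₀ (hVpos x hx)]
    refine hasSum_le (fun n => ?_) ((hV x hx).mul_left (R 0)) (hU x hx)
    rw [mul_assoc]
    exact mul_le_mul_of_nonneg_right (hR n.zero_le) (mul_pos (hv n) (pow_pos hx.1 _)).le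
  · filter_upwards [hmem] with x hx
    have h1 : (L - R 0) * v 0 * x ≤ L * V x - U x := by
      have hs := ((hV x hx).mul_left L).sub (hU x hx)
      have := le_hasSum hs 0 fun n _ => ?_
      · simp only [zero_add, pow_one] at this
        linarith
      · have := mul_nonneg (sub_nonneg.2 (hRL n)) (mul_pos (hv n) (pow_pos hx.1 (n + 1))).le
        linarith
    have hVx := hVpos x hx
    rw [inv_div, div_le_iff₀ hVx, sub_mul, mul_assoc _ (x / V x), div_mul_cancel₀ _ hVx.ne']
    linarith

theorem tendsto_div_nhdsLT_one_of_hasSum {v R : ℕ → ℝ} {L : ℝ} (hv : ∀ n, 0 < v n)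
    (hR0 : ∀ n, 0 ≤ R n) (hRL : ∀ n, R n ≤ L) (hRlim : Tendsto R atTop (nhds L)) {U V : ℝ → ℝ}
    (hV : ∀ x ∈ Ioo (0 : ℝ) 1, HasSum (fun n => v n * x ^ (n + 1)) (V x))
    (hU : ∀ x ∈ Ioo (0 : ℝ) 1, HasSum (fun n => R n * v n * x ^ (n + 1)) (U x))
    (hVlim : Tendsto V (nhdsWithin 1 (Iio 1)) atTop) :
    Tendsto (fun x => U x / V x) (nhdsWithin 1 (Iio 1)) (nhds L) := by
  have hmem : Ioo (0 : ℝ) 1 ∈ nhdsWithin (1 : ℝ) (Iio 1) := Ioo_mem_nhdsLT zero_lt_one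
  have hVpos : ∀ x ∈ Ioo (0 : ℝ) 1, 0 < V x := fun x hx =>
    HasSum.pos_of_nonneg (fun n => (mul_pos (hv n) (pow_pos hx.1 _)).le) 0
      (mul_pos (hv 0) (pow_pos hx.1 _)) (hV x hx)
  refine tendsto_order.2 ⟨fun l hl => ?_, fun l hl => ?_⟩
  · obtain ⟨m, hlm, hmL⟩ := exists_between hl
    obtain ⟨N, hN⟩ := eventually_atTop.1 (hRlim.eventually_const_lt hmL)
    set C := ∑ n ∈ Finset.range N, |m| * v n
    filter_upwards [hmem, hVlim.eventually_gt_atTop (C / (m - l))] with x hx hCx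
    have hVx := hVpos x hx
    rw [div_lt_iff₀ (sub_pos.2 hlm)] at hCx
    rw [lt_div_iff₀ hVx]
    have hs := (hU x hx).sub ((hV x hx).mul_left m)
    have hle : ∑ n ∈ Finset.range N, (R n * v n * x ^ (n + 1) - m * (v n * x ^ (n + 1)))
        ≤ U x - m * V x := by
      refine sum_le_hasSum _ (fun n hn => ?_) hs
      have hn' : N ≤ n := by simpa using hn
      have := mul_nonneg (sub_nonneg.2 (hN n hn').le) (mul_pos (hv n) (pow_pos hx.1 (n + 1))).le
      linarith
    have hC : -C ≤ ∑ n ∈ Finset.range N, (R n * v n * x ^ (n + 1) - m * (v n * x ^ (n + 1))) := by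
      rw [← Finset.sum_neg_distrib]
      refine Finset.sum_le_sum fun n _ => ?_
      have h0 : 0 ≤ R n * v n * x ^ (n + 1) :=
        mul_nonneg (mul_nonneg (hR0 n) (hv n).le) (pow_pos hx.1 _).le
      have h1 : v n * x ^ (n + 1) ≤ v n :=
        mul_le_of_le_one_right (hv n).le (pow_le_one₀ hx.1.le hx.2.le)
      have h2 : m * (v n * x ^ (n + 1)) ≤ |m| * (v n * x ^ (n + 1)) :=
        mul_le_mul_of_nonneg_right (le_abs_self m) (mul_pos (hv n) (pow_pos hx.1 _)).le
      have h3 := mul_le_mul_of_nonneg_left h1 (abs_nonneg m)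
      linarith
    linarith
  · filter_upwards [hmem] with x hx
    refine lt_of_le_of_lt ?_ hl
    rw [div_le_iff₀ (hVpos x hx)]
    refine hasSum_le (fun n => ?_) (hU x hx) ((hV x hx).mul_left L)
    rw [mul_assoc]
    exact mul_le_mul_of_nonneg_right (hRL n) (mul_pos (hv n) (pow_pos hx.1 _)).le

theorem shiftedFact_zero (a : ℝ) : shiftedFact a 0 = 1 := by
  simp [shiftedFact]

theorem shiftedFact_succ (a : ℝ) (n : ℕ) : shiftedFact a (n + 1) = shiftedFact a n * (a + n) :=
  Finset.prod_range_succ _ _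

theorem shiftedFact_pos {a : ℝ} (ha : 0 < a) (n : ℕ) : 0 < shiftedFact a n :=
  Finset.prod_pos fun _ _ => by positivity

theorem ascPochhammer_smeval_eq_shiftedFact (a : ℝ) (n : ℕ) :
    (ascPochhammer ℕ n).smeval a = shiftedFact a n := by
  induction n with
  | zero => simp [shiftedFact_zero]
  | succ n ih =>
    rw [ascPochhammer_succ_right, Polynomial.smeval_mul, ih, shiftedFact_succ]
    simp [Polynomial.smeval_add, Polynomial.smeval_natCast]

theorem hasSum_shiftedFact_div_factorial (d : ℝ) {x : ℝ} (hx : x ∈ Ioo (0 : ℝ) 1) :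
    HasSum (fun n : ℕ => shiftedFact d n / (n.factorial : ℝ) * x ^ n) ((1 - x) ^ (-d)) := by
  have h := (Real.one_div_one_sub_rpow_hasFPowerSeriesOnBall_zero d).hasSum (y := x) (by
    simp only [Metric.mem_eball, edist_zero_right]
    rw [← ofReal_norm, ← ENNReal.ofReal_one, ENNReal.ofReal_lt_ofReal_iff zero_lt_one,
      Real.norm_of_nonneg hx.1.le]
    exact hx.2)
  rw [zero_add, one_div, ← Real.rpow_neg (by linarith [hx.2])] at h
  refine h.congr_fun fun n => ?_
  rw [FormalMultilinearSeries.ofScalars_apply_eq, smul_eq_mul, Ring.choose,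
    show d + n - 1 - n + 1 = d by ring, ← ascPochhammer_smeval_eq_shiftedFact,
    ← Ring.factorial_nsmul_multichoose_eq_ascPochhammer, nsmul_eq_mul,
    mul_div_cancel_left₀ _ (by positivity)]

/-- The ratio of the `n`-th Taylor coefficients of `F(a,b;c;x)` and `(1 - x) ^ (-(a + b - c))`. -/
noncomputable def coeffRatio (a b c : ℝ) (n : ℕ) : ℝ :=
  shiftedFact a n * shiftedFact b n / (shiftedFact c n * shiftedFact (a + b - c) n)

theorem coeffRatio_pos {a b c : ℝ} (ha : 0 < a) (hb : 0 < b) (hc : 0 < c) (hd : 0 < a + b - c)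
    (n : ℕ) : 0 < coeffRatio a b c n :=
  div_pos (mul_pos (shiftedFact_pos ha n) (shiftedFact_pos hb n))
    (mul_pos (shiftedFact_pos hc n) (shiftedFact_pos hd n))

theorem coeffRatio_strictMono {a b c : ℝ} (ha : 0 < a) (hb : 0 < b) (hac : a < c) (hbc : b < c)
    (hd : 0 < a + b - c) : StrictMono (coeffRatio a b c) := by
  have hc : 0 < c := ha.trans hac
  refine strictMono_nat_of_lt_succ fun n => ?_
  have hcn : 0 < (c + n) * (a + b - c + n) := by positivity
  have hstep : coeffRatio a b c (n + 1) =
      coeffRatio a b c n * ((a + n) * (b + n) / ((c + n) * (a + b - c + n))) := by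
    simp only [coeffRatio, shiftedFact_succ]
    rw [div_mul_div_comm]
    congr 1 <;> ring
  rw [hstep]
  refine lt_mul_of_one_lt_right (coeffRatio_pos ha hb hc hd n) ((one_lt_div hcn).2 ?_)
  nlinarith [mul_pos (sub_pos.2 hac) (sub_pos.2 hbc)]

theorem tendsto_coeffRatio {a b c : ℝ} (ha : 0 < a) (hb : 0 < b) (hc : 0 < c)
    (hd : 0 < a + b - c) :
    Tendsto (fun n => coeffRatio a b c (n + 1)) atTop
      (nhds (Real.Gamma c * Real.Gamma (a + b - c) / (Real.Gamma a * Real.Gamma b))) := by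
  have h := ((Real.GammaSeq_tendsto_Gamma c).mul (Real.GammaSeq_tendsto_Gamma (a + b - c))).div
    ((Real.GammaSeq_tendsto_Gamma a).mul (Real.GammaSeq_tendsto_Gamma b))
    (mul_pos (Real.Gamma_pos_of_pos ha) (Real.Gamma_pos_of_pos hb)).ne'
  refine h.congr' ?_
  filter_upwards [eventually_gt_atTop 0] with n hn
  have hn' : (0 : ℝ) < n := Nat.cast_pos.2 hn
  have hpow : (n : ℝ) ^ c * (n : ℝ) ^ (a + b - c) = (n : ℝ) ^ a * (n : ℝ) ^ b := by
    rw [← Real.rpow_add hn', ← Real.rpow_add hn']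
    congr 1
    ring
  have hseq (s : ℝ) : Real.GammaSeq s n = (n : ℝ) ^ s * n.factorial / shiftedFact s (n + 1) := rfl
  have h1 := (shiftedFact_pos ha (n + 1)).ne'
  have h2 := (shiftedFact_pos hb (n + 1)).ne'
  have h3 := (shiftedFact_pos hc (n + 1)).ne'
  have h4 := (shiftedFact_pos hd (n + 1)).ne'
  have h5 := (Real.rpow_pos_of_pos hn' a).ne'
  have h6 := (Real.rpow_pos_of_pos hn' b).ne'
  have h7 : (n.factorial : ℝ) ≠ 0 := by positivity
  simp only [Pi.div_apply, hseq, coeffRatio]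
  field_simp
  linear_combination hpow

theorem hasSum_hypF {a b c : ℝ} (hc : 0 < c) (hd : 0 < a + b - c) {M : ℝ}
    (hM : ∀ n, |coeffRatio a b c n| ≤ M) {x : ℝ} (hx : x ∈ Ioo (0 : ℝ) 1) :
    HasSum (fun n : ℕ => coeffRatio a b c n * (shiftedFact (a + b - c) n / (n.factorial : ℝ))
      * x ^ n) (hypF a b c x) := by
  have hterm (n : ℕ) : coeffRatio a b c n * (shiftedFact (a + b - c) n / (n.factorial : ℝ)) =
      shiftedFact a n * shiftedFact b n / (shiftedFact c n * (n.factorial : ℝ)) := by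
    have h3 := (shiftedFact_pos hc n).ne'
    have h4 := (shiftedFact_pos hd n).ne'
    rw [coeffRatio]
    field_simp
  have hsum : Summable fun n : ℕ => coeffRatio a b c n *
      (shiftedFact (a + b - c) n / (n.factorial : ℝ)) * x ^ n := by
    refine Summable.of_norm_bounded
      ((hasSum_shiftedFact_div_factorial (a + b - c) hx).summable.mul_left M) fun n => ?_
    have h0 : 0 ≤ shiftedFact (a + b - c) n / (n.factorial : ℝ) * x ^ n :=
      mul_nonneg (div_nonneg (shiftedFact_pos hd n).le (by positivity)) (pow_pos hx.1 n).le
    rw [mul_assoc, norm_mul, Real.norm_eq_abs, Real.norm_of_nonneg h0]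
    exact mul_le_mul_of_nonneg_right (hM n) h0
  convert hsum.hasSum using 1
  exact tsum_congr fun n => by rw [hterm]

theorem stmt16 (a b c : ℝ) (ha : 0 < a) (hb : 0 < b)
    (ha' : a < min c 1) (hb' : b < min c 1) (hcab : c ≤ a + b) (hlt : c < a + b)
    (f : ℝ → ℝ)
    (hf : ∀ r, f r = (Kg a b c r - betaR a b / 2) / ((1 - r ^ 2) ^ (-(a + b - c)) - 1)) :
    StrictMonoOn f (Set.Ioo 0 1) ∧
    Tendsto f (nhdsWithin 0 (Set.Ioi 0)) (nhds (a * b * betaR a b / (2 * c * (a + b - c)))) ∧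
    Tendsto f (nhdsWithin 1 (Set.Iio 1)) (nhds (betaR c (a + b - c) / 2)) := by
  have hac : a < c := ha'.trans_le (min_le_left _ _)
  have hbc : b < c := hb'.trans_le (min_le_left _ _)
  have hc : 0 < c := ha.trans hac
  have hd : 0 < a + b - c := sub_pos.2 hlt
  have hGa := Real.Gamma_pos_of_pos ha
  have hGb := Real.Gamma_pos_of_pos hb
  have hGab := Real.Gamma_pos_of_pos (add_pos ha hb)
  have hB : 0 < betaR a b / 2 := half_pos (div_pos (mul_pos hGa hGb) hGab)
  set L := Real.Gamma c * Real.Gamma (a + b - c) / (Real.Gamma a * Real.Gamma b) with hL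
  have hmono := coeffRatio_strictMono ha hb hac hbc hd
  have hlim : Tendsto (fun n => coeffRatio a b c (n + 1)) atTop (nhds L) :=
    tendsto_coeffRatio ha hb hc hd
  have hRL (n : ℕ) : coeffRatio a b c n ≤ L :=
    hmono.monotone.ge_of_tendsto ((tendsto_add_atTop_iff_nat 1).1 hlim) n
  have hR0 (n : ℕ) : 0 ≤ coeffRatio a b c n := (coeffRatio_pos ha hb hc hd n).le
  set R : ℕ → ℝ := fun n => coeffRatio a b c (n + 1) with hR
  set v : ℕ → ℝ := fun n => shiftedFact (a + b - c) (n + 1) / ((n + 1).factorial : ℝ) with hv_def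
  have hv (n : ℕ) : 0 < v n := div_pos (shiftedFact_pos hd _) (by positivity)
  have hRmono : StrictMono R := fun m n hmn => hmono (by lia)
  set V : ℝ → ℝ := fun x => (1 - x) ^ (-(a + b - c)) - 1 with hV_def
  set U : ℝ → ℝ := fun x => hypF a b c x - 1 with hU_def
  have hV (x : ℝ) (hx : x ∈ Ioo (0 : ℝ) 1) : HasSum (fun n => v n * x ^ (n + 1)) (V x) := by
    have h := (hasSum_nat_add_iff' 1).2 (hasSum_shiftedFact_div_factorial (a + b - c) hx)
    simpa only [Finset.sum_range_one, shiftedFact_zero, Nat.factorial_zero, Nat.cast_one, div_one,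
      pow_zero, mul_one] using h
  have hU (x : ℝ) (hx : x ∈ Ioo (0 : ℝ) 1) :
      HasSum (fun n => R n * v n * x ^ (n + 1)) (U x) := by
    have h := (hasSum_nat_add_iff' 1).2
      (hasSum_hypF hc hd (fun n => (abs_of_nonneg (hR0 n)).trans_le (hRL n)) hx)
    have h0 : coeffRatio a b c 0 * (shiftedFact (a + b - c) 0 / ((0 : ℕ).factorial : ℝ)) * x ^ 0
        = 1 := by
      simp [coeffRatio, shiftedFact_zero]
    rw [Finset.sum_range_one, h0] at h
    exact h
  have hfUV : f = fun r => betaR a b / 2 * (U (r ^ 2) / V (r ^ 2)) := by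
    funext r
    rw [hf, Kg, hU_def, hV_def]
    ring
  have hsq (r : ℝ) (hr : r ∈ Ioo (0 : ℝ) 1) : r ^ 2 ∈ Ioo (0 : ℝ) 1 :=
    ⟨pow_pos hr.1 2, pow_lt_one₀ hr.1.le hr.2 two_ne_zero⟩
  refine ⟨fun r hr s hs hrs => ?_, ?_, ?_⟩
  · rw [hfUV]
    exact mul_lt_mul_of_pos_left (div_lt_div_of_hasSum_of_strictMono hv hRmono (hsq r hr).1
      (pow_lt_pow_left₀ hrs hr.1.le two_ne_zero) (hV _ (hsq r hr)) (hU _ (hsq r hr))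
      (hV _ (hsq s hs)) (hU _ (hsq s hs))) hB
  · have hV' : HasDerivAt V (v 0) 0 := by
      have h : HasDerivAt V _ 0 := (((hasDerivAt_id (0 : ℝ)).const_sub 1).rpow_const (p := -(a + b - c))
        (Or.inl (by simp))).sub_const 1
      refine h.congr_deriv ?_
      simp [hv_def, shiftedFact]
    have h := tendsto_div_nhdsGT_zero_of_hasSum hv hRmono.monotone (fun n => hRL (n + 1)) hV hU hV'
      (by simp [hV_def])
    have hsq0 : Tendsto (fun r : ℝ => r ^ 2) (nhdsWithin 0 (Ioi 0)) (nhdsWithin 0 (Ioi 0)) := by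
      refine tendsto_nhdsWithin_iff.2 ⟨?_, ?_⟩
      · exact ((continuous_pow 2).tendsto' (0 : ℝ) 0 (by simp)).mono_left nhdsWithin_le_nhds
      · filter_upwards [self_mem_nhdsWithin] with r hr using pow_pos (mem_Ioi.1 hr) 2
    have hval : a * b * betaR a b / (2 * c * (a + b - c)) = betaR a b / 2 * R 0 := by
      simp only [hR, coeffRatio, shiftedFact, zero_add, Finset.prod_range_one, Nat.cast_zero,
        add_zero]
      field_simp
    rw [hfUV, hval]
    exact (h.comp hsq0).const_mul (betaR a b / 2)
  · have hVlim : Tendsto V (nhdsWithin 1 (Iio 1)) atTop := by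
      have h1 : Tendsto (fun x : ℝ => 1 - x) (nhdsWithin 1 (Iio 1)) (nhdsWithin 0 (Ioi 0)) := by
        refine tendsto_nhdsWithin_iff.2 ⟨?_, ?_⟩
        · exact ((continuous_const.sub continuous_id).tendsto' (1 : ℝ) 0 (by simp)).mono_left
            nhdsWithin_le_nhds
        · filter_upwards [self_mem_nhdsWithin] with r hr using sub_pos.2 (mem_Iio.1 hr)
      exact tendsto_atTop_add_const_right _ _
        ((tendsto_rpow_neg_nhdsGT_zero (neg_lt_zero.2 hd)).comp h1)
    have h := tendsto_div_nhdsLT_one_of_hasSum hv (fun n => hR0 (n + 1)) (fun n => hRL (n + 1))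
      hlim hV hU hVlim
    have hsq1 : Tendsto (fun r : ℝ => r ^ 2) (nhdsWithin 1 (Iio 1)) (nhdsWithin 1 (Iio 1)) := by
      refine tendsto_nhdsWithin_iff.2 ⟨?_, ?_⟩
      · exact ((continuous_pow 2).tendsto' (1 : ℝ) 1 (by simp)).mono_left nhdsWithin_le_nhds
      · filter_upwards [Ioo_mem_nhdsLT (zero_lt_one (α := ℝ))] with r hr using (hsq r hr).2
    have hval : betaR c (a + b - c) / 2 = betaR a b / 2 * L := by
      rw [hL, betaR, betaR, add_sub_cancel]
      field_simp
    rw [hfUV, hval]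
    exact (h.comp hsq1).const_mul (betaR a b / 2)
end

section
/- Let 0 < a < c ≤ 1, b = c−a, R = −Ψ(a) − Ψ(c−a) − 2γ, and B = B(a, c−a). Then the function f(r) = 𝕂_{a,c}(r) + log r', where r' = √(1−r²), is strictly decreasing on [0,1), with f(0) = B/2 and f(r) → R/2 as r → 1−; moreover, all Maclaurin coefficients of f except the constant term are negative. -/
open Filter Set

/-- Digamma function . -/
noncomputable def digammaR (x : ℝ) : ℝ := deriv Real.Gamma x / Real.Gamma x

/-- The digamma function increases on the positive axis. -/
theorem monotoneOn_digammaR : MonotoneOn digammaR (Ioi 0) := by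
  have hdiff : ∀ x ∈ Ioi (0 : ℝ), DifferentiableAt ℝ Real.Gamma x := fun x hx =>
    Real.differentiableOn_Gamma_Ioi.differentiableAt (Ioi_mem_nhds hx)
  have hne : ∀ x ∈ Ioi (0 : ℝ), Real.Gamma x ≠ 0 := fun x hx => (Real.Gamma_pos_of_pos hx).ne'
  refine (Real.convexOn_log_Gamma.monotoneOn_deriv
    fun x hx => (hdiff x hx).log (hne x hx)).congr fun x hx => ?_
  exact deriv.log (hdiff x hx) (hne x hx)

theorem digammaR_add_one {x : ℝ} (hx : 0 < x) : digammaR (x + 1) = digammaR x + 1 / x := by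
  have hdiff : ∀ y : ℝ, 0 < y → DifferentiableAt ℝ Real.Gamma y := fun y hy =>
    Real.differentiableOn_Gamma_Ioi.differentiableAt (Ioi_mem_nhds hy)
  have hshift : HasDerivAt (fun y => Real.Gamma (y + 1)) (deriv Real.Gamma (x + 1)) x :=
    (hdiff (x + 1) (by positivity)).hasDerivAt.comp_add_const x 1
  have hmul : HasDerivAt (fun y => y * Real.Gamma y)
      (1 * Real.Gamma x + x * deriv Real.Gamma x) x :=
    (hasDerivAt_id x).mul (hdiff x hx).hasDerivAt
  have heq : (fun y => Real.Gamma (y + 1)) =ᶠ[nhds x] fun y => y * Real.Gamma y := by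
    filter_upwards [lt_mem_nhds hx] with y hy
    exact Real.Gamma_add_one hy.ne'
  have hderiv := hshift.unique (hmul.congr_of_eventuallyEq heq)
  have hG := (Real.Gamma_pos_of_pos hx).ne'
  have hx' := hx.ne'
  rw [digammaR, digammaR, hderiv, Real.Gamma_add_one hx']
  field_simp
  ring

/-- A solution of `f (x + 1) = f x + 1 / x` varies by at most `k / m` on `[m, m + k]`. -/
theorem apply_add_nat_le {f : ℝ → ℝ} (hf1 : ∀ x, 0 < x → f (x + 1) = f x + 1 / x)
    {m : ℝ} (hm : 0 < m) (k : ℕ) : f (m + k) ≤ f m + k / m := by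
  induction k with
  | zero => simp
  | succ k ih =>
    have h := hf1 (m + k) (by positivity)
    have h2 : 1 / (m + k) ≤ 1 / m :=
      one_div_le_one_div_of_le hm (le_add_of_nonneg_right k.cast_nonneg)
    push_cast
    rw [← add_assoc, h, add_div]
    linarith

/-- Monotone solutions of `f (x + 1) = f x + 1 / x` on the positive axis differ by a constant. -/
theorem sub_apply_one_eq_of_monotoneOn {f g : ℝ → ℝ} (hf : MonotoneOn f (Ioi 0))
    (hg : MonotoneOn g (Ioi 0)) (hf1 : ∀ x, 0 < x → f (x + 1) = f x + 1 / x)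
    (hg1 : ∀ x, 0 < x → g (x + 1) = g x + 1 / x) {x : ℝ} (hx : 0 < x) :
    f x - f 1 = g x - g 1 := by
  have hper : ∀ (y : ℝ), 0 < y → ∀ m : ℕ, f (y + m) - g (y + m) = f y - g y := by
    intro y hy m
    induction m with
    | zero => simp
    | succ m ih =>
      push_cast
      rw [← add_assoc, hf1 _ (by positivity), hg1 _ (by positivity), ← ih]
      ring
  obtain ⟨k, hk⟩ := exists_nat_ge (x + 1)
  have hbound : ∀ h : ℝ → ℝ, MonotoneOn h (Ioi 0) →
      (∀ y, 0 < y → h (y + 1) = h y + 1 / y) → ∀ m : ℕ, 0 < m →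
      |h (x + m) - h (1 + m)| ≤ k / m := by
    intro h hmono hh m hm
    have hm' : (0 : ℝ) < m := Nat.cast_pos.mpr hm
    have hle := apply_add_nat_le hh hm' k
    have h1 := hmono (a := m) (b := x + m) hm' (by simp; positivity) (by linarith)
    have h2 := hmono (a := m) (b := 1 + m) hm' (by simp; positivity) (by linarith)
    have h3 := hmono (a := x + m) (b := m + k) (by simp; positivity) (by simp; positivity)
      (by linarith)
    have h4 := hmono (a := 1 + m) (b := m + k) (by simp; positivity) (by simp; positivity)
      (by linarith)
    rw [abs_le]
    constructor <;> linarith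
  have hle : ∀ m : ℕ, 0 < m → |(f x - g x) - (f 1 - g 1)| ≤ (2 * k : ℝ) / m := by
    intro m hm
    have h1 := hbound f hf hf1 m hm
    have h2 := hbound g hg hg1 m hm
    rw [← hper x hx m, ← hper 1 one_pos m, mul_div_assoc]
    rw [abs_le] at *
    constructor <;> linarith [h1.1, h1.2, h2.1, h2.2]
  have hzero : |(f x - g x) - (f 1 - g 1)| ≤ 0 :=
    ge_of_tendsto (tendsto_const_div_atTop_nhds_zero_nat (2 * k : ℝ))
      (eventually_atTop.mpr ⟨1, fun m hm => hle m hm⟩)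
  have := abs_nonpos_iff.mp hzero
  linarith

theorem Gamma_add_nat_eq {a : ℝ} (ha : 0 < a) (n : ℕ) :
    Real.Gamma (a + n) = Real.Gamma a * shiftedFact a n := by
  induction n with
  | zero => simp [shiftedFact]
  | succ n ih =>
    push_cast
    rw [← add_assoc, Real.Gamma_add_one (by positivity), ih, shiftedFact_succ]
    ring

/-- The `n`-th Maclaurin coefficient of `B(a,b) F(a,b;a+b;x)`. -/
noncomputable def betaCoeff (a b : ℝ) (n : ℕ) : ℝ :=
  Real.Gamma (a + n) * Real.Gamma (b + n) / (Real.Gamma (a + b + n) * n.factorial)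

theorem betaCoeff_comm (a b : ℝ) (n : ℕ) : betaCoeff a b n = betaCoeff b a n := by
  rw [betaCoeff, betaCoeff, mul_comm (Real.Gamma (a + n)), add_comm a b]

theorem betaCoeff_pos {a b : ℝ} (ha : 0 < a) (hb : 0 < b) (n : ℕ) : 0 < betaCoeff a b n := by
  have h1 := Real.Gamma_pos_of_pos (show 0 < a + n by positivity)
  have h2 := Real.Gamma_pos_of_pos (show 0 < b + n by positivity)
  have h3 := Real.Gamma_pos_of_pos (show 0 < a + b + n by positivity)
  rw [betaCoeff]
  positivity

theorem betaCoeff_zero (a b : ℝ) : betaCoeff a b 0 = betaR a b := by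
  simp [betaCoeff, betaR]

theorem betaCoeff_eq_shiftedFact {a b : ℝ} (ha : 0 < a) (hb : 0 < b) (n : ℕ) :
    betaCoeff a b n = betaR a b *
      (shiftedFact a n * shiftedFact b n / (shiftedFact (a + b) n * n.factorial)) := by
  rw [betaCoeff, betaR, Gamma_add_nat_eq ha, Gamma_add_nat_eq hb,
    Gamma_add_nat_eq (add_pos ha hb), div_mul_div_comm]
  congr 1 <;> ring

theorem betaCoeff_succ {a b : ℝ} (ha : 0 < a) (hb : 0 < b) (n : ℕ) :
    (n + 1 : ℝ) * betaCoeff a b (n + 1) =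
      betaCoeff a b n * ((a + n) * (b + n) / (a + b + n)) := by
  have h3 := (Real.Gamma_pos_of_pos (show 0 < a + b + n by positivity)).ne'
  have h4 : a + b + n ≠ 0 := by positivity
  have h5 : a + n ≠ 0 := by positivity
  have h6 : b + n ≠ 0 := by positivity
  simp only [betaCoeff, Nat.factorial_succ]
  push_cast
  rw [← add_assoc, ← add_assoc, ← add_assoc, Real.Gamma_add_one h4, Real.Gamma_add_one h5,
    Real.Gamma_add_one h6]
  field_simp

theorem nat_mul_betaCoeff_succ_sub {a b : ℝ} (ha : 0 < a) (hb : 0 < b) (n : ℕ) :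
    ((n + 1 : ℕ) : ℝ) * betaCoeff a b (n + 1) - n * betaCoeff a b n =
      betaCoeff a b n * (a * b / (a + b + n)) := by
  have h4 : a + b + n ≠ 0 := by positivity
  push_cast
  rw [betaCoeff_succ ha hb]
  field_simp
  ring

theorem strictMono_nat_mul_betaCoeff {a b : ℝ} (ha : 0 < a) (hb : 0 < b) :
    StrictMono fun n : ℕ => (n : ℝ) * betaCoeff a b n := by
  refine strictMono_nat_of_lt_succ fun n => sub_pos.mp ?_
  rw [nat_mul_betaCoeff_succ_sub ha hb]
  have := betaCoeff_pos ha hb n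
  positivity

theorem tendsto_nat_mul_betaCoeff {a b : ℝ} (ha : 0 < a) (hb : 0 < b) :
    Tendsto (fun n : ℕ => (n : ℝ) * betaCoeff a b n) atTop (nhds 1) := by
  have hGa := (Real.Gamma_pos_of_pos ha).ne'
  have hGb := (Real.Gamma_pos_of_pos hb).ne'
  have hGc := (Real.Gamma_pos_of_pos (add_pos ha hb)).ne'
  have hlim : Tendsto (fun n : ℕ => betaR a b *
      (Real.GammaSeq (a + b) n / (Real.GammaSeq a n * Real.GammaSeq b n))) atTop (nhds 1) := by
    have h := ((Real.GammaSeq_tendsto_Gamma (a + b)).div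
      ((Real.GammaSeq_tendsto_Gamma a).mul (Real.GammaSeq_tendsto_Gamma b))
      (mul_ne_zero hGa hGb)).const_mul (betaR a b)
    have h1 : betaR a b * (Real.Gamma (a + b) / (Real.Gamma a * Real.Gamma b)) = 1 := by
      rw [betaR]
      field_simp
    rwa [h1] at h
  rw [← tendsto_add_atTop_iff_nat 1]
  refine hlim.congr' ?_
  filter_upwards [eventually_gt_atTop 0] with n hn
  have hn' : (0 : ℝ) < n := Nat.cast_pos.mpr hn
  have hpa := (Real.rpow_pos_of_pos hn' a).ne'
  have hpb := (Real.rpow_pos_of_pos hn' b).ne'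
  have hsa := (shiftedFact_pos ha (n + 1)).ne'
  have hsb := (shiftedFact_pos hb (n + 1)).ne'
  have hsc := (shiftedFact_pos (add_pos ha hb) (n + 1)).ne'
  have hfac : (n.factorial : ℝ) ≠ 0 := by positivity
  have hn1 : (n + 1 : ℝ) ≠ 0 := by positivity
  have hseq : ∀ s : ℝ, Real.GammaSeq s n = (n : ℝ) ^ s * n.factorial / shiftedFact s (n + 1) :=
    fun s => rfl
  rw [betaCoeff_eq_shiftedFact ha hb, hseq, hseq, hseq, Real.rpow_add hn', Nat.factorial_succ]
  push_cast
  field_simp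

/-- The `(n+1)`-st Maclaurin coefficient of `B(a,b) F(a,b;a+b;x) + log (1 - x)`. -/
noncomputable def betaDefect (a b : ℝ) (n : ℕ) : ℝ := betaCoeff a b (n + 1) - 1 / (n + 1)

theorem betaDefect_comm (a b : ℝ) (n : ℕ) : betaDefect a b n = betaDefect b a n := by
  rw [betaDefect, betaDefect, betaCoeff_comm]

theorem nat_mul_betaCoeff_lt_one {a b : ℝ} (ha : 0 < a) (hb : 0 < b) (n : ℕ) :
    n * betaCoeff a b n < 1 :=
  (strictMono_nat_mul_betaCoeff ha hb n.lt_succ_self).trans_le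
    ((strictMono_nat_mul_betaCoeff ha hb).monotone.ge_of_tendsto
      (tendsto_nat_mul_betaCoeff ha hb) _)

theorem betaDefect_neg {a b : ℝ} (ha : 0 < a) (hb : 0 < b) (n : ℕ) : betaDefect a b n < 0 := by
  have h := nat_mul_betaCoeff_lt_one ha hb (n + 1)
  push_cast at h
  rw [betaDefect, sub_neg, lt_div_iff₀ (by positivity), mul_comm]
  exact h

theorem le_nat_mul_betaCoeff {a b : ℝ} (ha : 0 < a) (hb : 0 < b) (n : ℕ) :
    1 - 2 * (a * b) / (n + 1) ≤ ((n + 1 : ℕ) : ℝ) * betaCoeff a b (n + 1) := by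
  have hanti : Antitone fun n : ℕ =>
      ((n + 1 : ℕ) : ℝ) * betaCoeff a b (n + 1) + 2 * (a * b) / ((n + 1 : ℕ) : ℝ) := by
    refine antitone_nat_of_succ_le fun n => ?_
    have h := nat_mul_betaCoeff_succ_sub ha hb (n + 1)
    have hlt := nat_mul_betaCoeff_lt_one ha hb (n + 1)
    have hN : (0 : ℝ) < ((n + 1 : ℕ) : ℝ) := Nat.cast_pos.mpr n.succ_pos
    have hN1 : (1 : ℝ) ≤ ((n + 1 : ℕ) : ℝ) := Nat.one_le_cast.mpr n.succ_pos
    have hs : ((n + 1 + 1 : ℕ) : ℝ) = ((n + 1 : ℕ) : ℝ) + 1 := Nat.cast_succ _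
    rw [hs] at h ⊢
    set N : ℝ := ((n + 1 : ℕ) : ℝ)
    have hu : betaCoeff a b (n + 1) ≤ 1 / N := by
      rw [le_div_iff₀ hN, mul_comm]
      exact hlt.le
    have h1 : betaCoeff a b (n + 1) * (a * b / (a + b + N)) ≤ 1 / N * (a * b / N) := by
      gcongr
      linarith
    have h2 : 1 / N * (a * b / N) ≤ 2 * (a * b) / N - 2 * (a * b) / (N + 1) := by
      have : 2 * (a * b) / N - 2 * (a * b) / (N + 1) - 1 / N * (a * b / N) =
          a * b * (N - 1) / (N * N * (N + 1)) := by
        field_simp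
        ring
      have h0 : 0 ≤ a * b * (N - 1) / (N * N * (N + 1)) := by
        have : 0 ≤ N - 1 := by linarith
        positivity
      linarith
    linarith
  have hlim : Tendsto (fun n : ℕ =>
      ((n + 1 : ℕ) : ℝ) * betaCoeff a b (n + 1) + 2 * (a * b) / ((n + 1 : ℕ) : ℝ))
      atTop (nhds (1 + 0)) :=
    ((tendsto_nat_mul_betaCoeff ha hb).add
      (tendsto_const_div_atTop_nhds_zero_nat (2 * (a * b)))).comp (tendsto_add_atTop_nat 1)
  have := hanti.le_of_tendsto hlim n
  push_cast at this ⊢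
  linarith

theorem summable_betaDefect {a b : ℝ} (ha : 0 < a) (hb : 0 < b) :
    Summable (betaDefect a b) := by
  have hs : Summable fun n : ℕ => 2 * (a * b) * (1 / ((n + 1 : ℕ) : ℝ) ^ 2) :=
    ((summable_nat_add_iff 1).mpr (Real.summable_one_div_nat_pow.mpr one_lt_two)).mul_left _
  refine hs.of_norm_bounded fun n => ?_
  have h := le_nat_mul_betaCoeff ha hb n
  push_cast at h ⊢
  rw [Real.norm_eq_abs, abs_of_neg (betaDefect_neg ha hb n), betaDefect]
  have hN : (0 : ℝ) < n + 1 := by positivity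
  have : 2 * (a * b) * (1 / ((n : ℝ) + 1) ^ 2) + (betaCoeff a b (n + 1) - 1 / ((n : ℝ) + 1)) =
      ((n + 1) * betaCoeff a b (n + 1) - (1 - 2 * (a * b) / (n + 1))) / (n + 1) := by
    field_simp
    ring
  have h0 : 0 ≤ ((n + 1) * betaCoeff a b (n + 1) - (1 - 2 * (a * b) / (n + 1))) / (n + 1 : ℝ) :=
    div_nonneg (by linarith) hN.le
  linarith

theorem betaCoeff_antitone_left {a a' b : ℝ} (ha : 0 < a) (hb : 0 < b) (haa : a ≤ a') (n : ℕ) :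
    betaCoeff a' b n ≤ betaCoeff a b n := by
  have ha' : 0 < a' := ha.trans_le haa
  have hx : 0 < a + n := by positivity
  have hy : 0 < a' + n := by positivity
  have hd : 0 < a' - a + b := by linarith
  have hwt : (a' - a) / (a' - a + b) + b / (a' - a + b) = 1 := by
    rw [← add_div, div_self hd.ne']
  have hP := Real.Gamma_pos_of_pos hx
  have hQ := Real.Gamma_pos_of_pos hy
  have hPb := Real.Gamma_pos_of_pos (show 0 < a + b + n by positivity)
  have hQb := Real.Gamma_pos_of_pos (show 0 < a' + b + n by positivity)
  have hB := Real.Gamma_pos_of_pos (show 0 < b + n by positivity)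
  have hconv := Real.convexOn_log_Gamma.2 (x := a + n) hx (y := a' + b + n)
    (show 0 < a' + b + n by positivity)
  have h1 := hconv (div_nonneg (sub_nonneg.mpr haa) hd.le) (div_nonneg hb.le hd.le) hwt
  have h2 := hconv (div_nonneg hb.le hd.le) (div_nonneg (sub_nonneg.mpr haa) hd.le)
    (by rw [add_comm]; exact hwt)
  simp only [smul_eq_mul, Function.comp_apply] at h1 h2
  rw [show (a' - a) / (a' - a + b) * (a + n) + b / (a' - a + b) * (a' + b + n) = a + b + n by
    field_simp; ring] at h1
  rw [show b / (a' - a + b) * (a + n) + (a' - a) / (a' - a + b) * (a' + b + n) = a' + n by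
    field_simp; ring] at h2
  have hsum : Real.log (Real.Gamma (a' + n)) + Real.log (Real.Gamma (a + b + n)) ≤
      Real.log (Real.Gamma (a + n)) + Real.log (Real.Gamma (a' + b + n)) := by
    have hwt' : b / (a' - a + b) = 1 - (a' - a) / (a' - a + b) := by linarith
    rw [hwt'] at h1 h2
    linarith
  rw [← Real.log_mul hQ.ne' hPb.ne', ← Real.log_mul hP.ne' hQb.ne',
    Real.log_le_log_iff (by positivity) (by positivity)] at hsum
  rw [betaCoeff, betaCoeff, div_le_div_iff₀ (by positivity) (by positivity)]
  calc _ = Real.Gamma (a' + n) * Real.Gamma (a + b + n) *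
        (Real.Gamma (b + n) * n.factorial) := by ring
    _ ≤ Real.Gamma (a + n) * Real.Gamma (a' + b + n) *
        (Real.Gamma (b + n) * n.factorial) := by gcongr
    _ = _ := by ring

/-- The Abel sum at `x = 1` of the Maclaurin series of `B(a,b) F(a,b;a+b;x) + log (1 - x)`. -/
noncomputable def betaConst (a b : ℝ) : ℝ := betaCoeff a b 0 + ∑' n, betaDefect a b n

theorem betaConst_comm (a b : ℝ) : betaConst a b = betaConst b a := by
  simp only [betaConst, betaCoeff_comm a b, betaDefect_comm a b]

theorem betaConst_antitone_left {a a' b : ℝ} (ha : 0 < a) (hb : 0 < b) (haa : a ≤ a') :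
    betaConst a' b ≤ betaConst a b :=
  add_le_add (betaCoeff_antitone_left ha hb haa 0)
    ((summable_betaDefect (ha.trans_le haa) hb).tsum_le_tsum
      (fun n => sub_le_sub_right (betaCoeff_antitone_left ha hb haa (n + 1)) _)
      (summable_betaDefect ha hb))

theorem betaCoeff_sub_add_one {a b : ℝ} (ha : 0 < a) (hb : 0 < b) (n : ℕ) :
    betaCoeff a b n - betaCoeff (a + 1) b n =
      (((n + 1 : ℕ) : ℝ) * betaCoeff a b (n + 1) - n * betaCoeff a b n) / a := by
  rw [nat_mul_betaCoeff_succ_sub ha hb]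
  have h3 := (Real.Gamma_pos_of_pos (show 0 < a + b + n by positivity)).ne'
  have h4 : a + b + n ≠ 0 := by positivity
  have h5 : a + n ≠ 0 := by positivity
  simp only [betaCoeff]
  rw [show a + 1 + n = a + n + 1 by ring, show a + 1 + b + n = a + b + n + 1 by ring,
    Real.Gamma_add_one h4, Real.Gamma_add_one h5]
  field_simp
  ring

theorem betaConst_add_one {a b : ℝ} (ha : 0 < a) (hb : 0 < b) :
    betaConst (a + 1) b = betaConst a b - 1 / a := by
  have hsum : HasSum (fun n => betaDefect a b n - betaDefect (a + 1) b n)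
      (∑' n, betaDefect a b n - ∑' n, betaDefect (a + 1) b n) :=
    (summable_betaDefect ha hb).hasSum.sub (summable_betaDefect (by positivity) hb).hasSum
  have hlim : Tendsto (fun N => ∑ n ∈ Finset.range N,
      (betaDefect a b n - betaDefect (a + 1) b n)) atTop
      (nhds ((1 - betaCoeff a b 1) / a)) := by
    have h := (((tendsto_nat_mul_betaCoeff ha hb).comp (tendsto_add_atTop_nat 1)).sub_const
      (betaCoeff a b 1)).div_const a
    refine h.congr fun N => ?_
    have hterm : ∀ n : ℕ, betaDefect a b n - betaDefect (a + 1) b n =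
        (((n + 1 + 1 : ℕ) : ℝ) * betaCoeff a b (n + 1 + 1) -
          ((n + 1 : ℕ) : ℝ) * betaCoeff a b (n + 1)) / a := by
      intro n
      rw [← betaCoeff_sub_add_one ha hb, betaDefect, betaDefect]
      ring
    rw [Finset.sum_congr rfl fun n _ => hterm n, ← Finset.sum_div,
      Finset.sum_range_sub fun n : ℕ => ((n + 1 : ℕ) : ℝ) * betaCoeff a b (n + 1)]
    simp
  have heq := tendsto_nhds_unique hsum.tendsto_sum_nat hlim
  have h0 := betaCoeff_sub_add_one ha hb 0
  simp only [zero_add, Nat.cast_one, Nat.cast_zero, zero_mul, one_mul, sub_zero] at h0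
  rw [sub_div] at heq
  rw [betaConst, betaConst]
  linarith

theorem betaConst_one_one : betaConst 1 1 = 0 := by
  have hcoeff : ∀ n : ℕ, betaCoeff 1 1 n = 1 / (n + 1) := by
    intro n
    have h1 : Real.Gamma (1 + n) = n.factorial := by
      rw [add_comm]; exact Real.Gamma_nat_eq_factorial n
    have h2 : Real.Gamma (1 + 1 + n) = (n + 1) * n.factorial := by
      rw [show (1 + 1 + n : ℝ) = 1 + n + 1 by ring, Real.Gamma_add_one (by positivity), h1]
      ring
    have hfac : (n.factorial : ℝ) ≠ 0 := by positivity
    rw [betaCoeff, h1, h2]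
    field_simp
  have hlim : Tendsto (fun N => ∑ n ∈ Finset.range N, betaDefect 1 1 n) atTop (nhds (0 - 1)) := by
    refine (tendsto_one_div_add_atTop_nhds_zero_nat.sub_const 1).congr fun N => ?_
    have hterm : ∀ n : ℕ, betaDefect 1 1 n = betaCoeff 1 1 (n + 1) - betaCoeff 1 1 n := fun n => by
      rw [betaDefect, hcoeff n]
    rw [Finset.sum_congr rfl fun n _ => hterm n, Finset.sum_range_sub, hcoeff, hcoeff]
    simp
  have heq := tendsto_nhds_unique
    (summable_betaDefect one_pos one_pos).hasSum.tendsto_sum_nat hlim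
  rw [betaConst, heq, hcoeff]
  simp

theorem betaConst_eq_digammaR {a b : ℝ} (ha : 0 < a) (hb : 0 < b) :
    betaConst a b = 2 * digammaR 1 - digammaR a - digammaR b := by
  have key : ∀ x y : ℝ, 0 < x → 0 < y →
      betaConst x y = betaConst 1 y + digammaR 1 - digammaR x := by
    intro x y hx hy
    have h := sub_apply_one_eq_of_monotoneOn (f := fun z => -betaConst z y) (g := digammaR)
      (fun z hz z' _ hzz => neg_le_neg (betaConst_antitone_left hz hy hzz))
      monotoneOn_digammaR (fun z hz => by rw [betaConst_add_one hz hy]; ring)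
      (fun z hz => digammaR_add_one hz) hx
    linarith
  rw [key a b ha hb, betaConst_comm 1 b, key b 1 hb one_pos, betaConst_one_one]
  ring

/-- The Maclaurin series of `B(a,b) F(a,b;a+b;x)` with the logarithmic singularity split off. -/
theorem betaR_mul_hypF {a b x : ℝ} (ha : 0 < a) (hb : 0 < b) (hx0 : 0 ≤ x) (hx1 : x < 1) :
    betaR a b * hypF a b (a + b) x =
      betaR a b + ∑' n, betaDefect a b n * x ^ (n + 1) - Real.log (1 - x) := by
  have hlog := Real.hasSum_pow_div_log_of_abs_lt_one (x := x) (by rwa [abs_of_nonneg hx0])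
  have hdef : Summable fun n => betaDefect a b n * x ^ (n + 1) := by
    refine (summable_betaDefect ha hb).norm.of_norm_bounded fun n => ?_
    rw [norm_mul, Real.norm_of_nonneg (pow_nonneg hx0 _)]
    exact mul_le_of_le_one_right (norm_nonneg _) (pow_le_one₀ hx0 hx1.le)
  have htail : HasSum (fun n => betaCoeff a b (n + 1) * x ^ (n + 1))
      (∑' n, betaDefect a b n * x ^ (n + 1) + -Real.log (1 - x)) := by
    refine (hdef.hasSum.add hlog).congr_fun fun n => ?_
    rw [betaDefect]
    ring
  have hfull := (hasSum_nat_add_iff (f := fun n => betaCoeff a b n * x ^ n) 1).mp htail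
  rw [hypF, ← tsum_mul_left]
  simp only [← mul_assoc, ← betaCoeff_eq_shiftedFact ha hb]
  rw [hfull.tsum_eq]
  simp only [Finset.sum_range_one, betaCoeff_zero, pow_zero, mul_one]
  ring


theorem stmt17 (a c : ℝ) (ha : 0 < a) (hac : a < c) (hc : c ≤ 1)
    (R B : ℝ) (hR : R = -digammaR a - digammaR (c - a) - 2 * (-digammaR 1))
    (hB : B = betaR a (c - a))
    (f : ℝ → ℝ)
    (hf : ∀ r, f r = Kg a (c - a) c r + Real.log (Real.sqrt (1 - r ^ 2))) :
    StrictAntiOn f (Set.Ico 0 1) ∧ f 0 = B / 2 ∧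
    Tendsto f (nhdsWithin 1 (Set.Iio 1)) (nhds (R / 2)) ∧
    ∃ coef : ℕ → ℝ, (∀ n, 1 ≤ n → coef n < 0) ∧
      ∀ r ∈ Set.Ico (0 : ℝ) 1, f r = B / 2 + ∑' n : ℕ, coef (n + 1) * r ^ (2 * (n + 1)) := by
  have hb : 0 < c - a := sub_pos.mpr hac
  set b := c - a with hb_def
  have hcab : c = a + b := by rw [hb_def]; ring
  have hpow : ∀ (r : ℝ) (n : ℕ), r ^ (2 * (n + 1)) = (r ^ 2) ^ (n + 1) := fun r n => pow_mul r 2 _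
  have hseries : ∀ r ∈ Set.Ico (0 : ℝ) 1,
      f r = B / 2 + ∑' n : ℕ, betaDefect a b n / 2 * r ^ (2 * (n + 1)) := by
    rintro r ⟨hr0, hr1⟩
    have hr2 : r ^ 2 < 1 := pow_lt_one₀ hr0 hr1 two_ne_zero
    have h := betaR_mul_hypF ha hb (sq_nonneg r) hr2
    have hhalf : ∑' n : ℕ, betaDefect a b n / 2 * r ^ (2 * (n + 1)) =
        (∑' n : ℕ, betaDefect a b n * (r ^ 2) ^ (n + 1)) / 2 := by
      rw [← tsum_div_const]
      exact tsum_congr fun n => by rw [hpow]; ring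
    rw [hf, Kg, Real.log_sqrt (by linarith), hhalf, hB, div_mul_eq_mul_div, hcab, h]
    ring
  have hsmall : ∀ r ∈ Set.Ico (0 : ℝ) 1, ∀ n : ℕ,
      ‖betaDefect a b n / 2 * r ^ (2 * (n + 1))‖ ≤ ‖betaDefect a b n / 2‖ := by
    rintro r ⟨hr0, hr1⟩ n
    rw [norm_mul, Real.norm_of_nonneg (pow_nonneg hr0 _)]
    exact mul_le_of_le_one_right (norm_nonneg _) (pow_le_one₀ hr0 hr1.le)
  have hbound : Summable fun n => ‖betaDefect a b n / 2‖ :=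
    ((summable_betaDefect ha hb).div_const 2).norm
  have hneg : ∀ n, betaDefect a b n / 2 < 0 := fun n =>
    div_neg_of_neg_of_pos (betaDefect_neg ha hb n) two_pos
  refine ⟨?_, ?_, ?_, fun n => betaDefect a b (n - 1) / 2, fun n _ => hneg _, hseries⟩
  · intro r hr s hs hrs
    rw [hseries r hr, hseries s hs]
    have hlt : ∀ n : ℕ, betaDefect a b n / 2 * s ^ (2 * (n + 1)) <
        betaDefect a b n / 2 * r ^ (2 * (n + 1)) := fun n =>
      mul_lt_mul_of_neg_left (pow_lt_pow_left₀ hrs hr.1 (by positivity)) (hneg n)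
    exact add_lt_add_right (Summable.tsum_lt_tsum (i := 0) (fun n => (hlt n).le) (hlt 0)
      (hbound.of_norm_bounded (hsmall s hs)) (hbound.of_norm_bounded (hsmall r hr))) _
  · rw [hseries 0 ⟨le_rfl, one_pos⟩]
    simp
  · have hmem : ∀ᶠ r in nhdsWithin (1 : ℝ) (Set.Iio 1), r ∈ Set.Ico (0 : ℝ) 1 := by
      filter_upwards [self_mem_nhdsWithin, mem_nhdsWithin_of_mem_nhds (lt_mem_nhds one_pos)]
        with r hr1 hr0
      exact ⟨le_of_lt hr0, hr1⟩
    have hlim : Tendsto (fun r : ℝ => ∑' n : ℕ, betaDefect a b n / 2 * r ^ (2 * (n + 1)))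
        (nhdsWithin 1 (Set.Iio 1)) (nhds (∑' n : ℕ, betaDefect a b n / 2)) := by
      refine tendsto_tsum_of_dominated_convergence hbound (fun n => ?_)
        (hmem.mono fun r hr n => hsmall r hr n)
      have hcont : Continuous fun r : ℝ => betaDefect a b n / 2 * r ^ (2 * (n + 1)) := by fun_prop
      simpa using (hcont.tendsto 1).mono_left nhdsWithin_le_nhds
    have hRB : B / 2 + ∑' n : ℕ, betaDefect a b n / 2 = R / 2 := by
      have h := betaConst_eq_digammaR ha hb
      rw [betaConst, betaCoeff_zero, ← hB] at h
      rw [tsum_div_const, ← add_div, h, hR]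
      ring
    rw [← hRB]
    exact (hlim.const_add (B / 2)).congr' (hmem.mono fun r hr => (hseries r hr).symm)
end
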